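/- Let w ∈ W be bigrassmannian with (w, i, j) ∈ Γ(W). (1) If there exists k ∈ I with k ≠ i such that s_k s_i = s_i s_k and s_k w = w s_p for some p ∈ I with s_j s_p ≠ s_p s_j, then there exist v ∈ W and j′ ∈ I such that (w, i, j) →_{(k,R)} (v, i, j′). (2) If there exists k ∈ I with k ≠ j such that s_k s_j = s_j s_k and s_p w = w s_k for some p ∈ I with s_i s_p ≠ s_p s_i, then there exist v ∈ W and i′ ∈ I such that (w, i, j) →_{(k,L)} (v, i′, j). -/

import Mathlib

open CoxeterSystem

namespace NilpotencyIndices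

variable {B : Type*} {W : Type*} [Group W] {M : CoxeterMatrix B}

/-- The set `Γ(W)` of triples `(w, i, j)` with `ℓ(sᵢ w sⱼ) = ℓ(w) - 2`
(stated as `ℓ(sᵢ w sⱼ) + 2 = ℓ(w)` to avoid truncated subtraction). -/
def InGamma (cs : CoxeterSystem M W) (x : W × B × B) : Prop :=
  cs.length (cs.simple x.2.1 * x.1 * cs.simple x.2.2) + 2 = cs.length x.1

/-- The weak left (Bruhat) order: `v ≤_L w` iff `ℓ(v) + ℓ(w v⁻¹) = ℓ(w)`. -/
def WeakLeftLE (cs : CoxeterSystem M W) (v w : W) : Prop :=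
  cs.length v + cs.length (w * v⁻¹) = cs.length w

/-- The weak right (Bruhat) order: `v ≤_R w` iff `ℓ(v) + ℓ(v⁻¹ w) = ℓ(w)`. -/
def WeakRightLE (cs : CoxeterSystem M W) (v w : W) : Prop :=
  cs.length v + cs.length (v⁻¹ * w) = cs.length w

/-- `v(α_a) = α_b`: the group-theoretic condition `v sₐ v⁻¹ = s_b` and `ℓ(v sₐ) = ℓ(v) + 1`. -/
def MapsSimple (cs : CoxeterSystem M W) (v : W) (a b : B) : Prop :=
  v * cs.simple a * v⁻¹ = cs.simple b ∧ cs.length (v * cs.simple a) = cs.length v + 1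

/-- `(w, i, j) →_L (u, i', j')` iff both triples are in `Γ(W)`, `u ≤_L w`, `j' = j`, and
`(w u⁻¹)(α_{i'}) = α_i`. -/
def RedL (cs : CoxeterSystem M W) (x y : W × B × B) : Prop :=
  InGamma cs x ∧ InGamma cs y ∧ WeakLeftLE cs y.1 x.1 ∧ y.2.2 = x.2.2 ∧
    MapsSimple cs (x.1 * y.1⁻¹) y.2.1 x.2.1

/-- `(w, i, j) →_R (u, i', j')` iff both triples are in `Γ(W)`, `u ≤_R w`, `i' = i`, and
`(u⁻¹ w)(α_j) = α_{j'}`. -/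
def RedR (cs : CoxeterSystem M W) (x y : W × B × B) : Prop :=
  InGamma cs x ∧ InGamma cs y ∧ WeakRightLE cs y.1 x.1 ∧ y.2.1 = x.2.1 ∧
    MapsSimple cs (y.1⁻¹ * x.1) x.2.2 y.2.2

/-- `→`: the reflexive-transitive closure of the union of `→_L` and `→_R`. -/
def Red (cs : CoxeterSystem M W) : (W × B × B) → (W × B × B) → Prop :=
  Relation.ReflTransGen (fun x y => RedL cs x y ∨ RedR cs x y)

/-- `↔`: the equivalence relation generated by `→`. -/
def EquivRed (cs : CoxeterSystem M W) : (W × B × B) → (W × B × B) → Prop :=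
  Relation.EqvGen (Red cs)

/-- The alternating word `a, b, a, b, …` with `n` letters, starting with `a`. -/
def altWord (a b : B) : ℕ → List B
  | 0 => []
  | n + 1 => a :: altWord b a n

/-- `w₀(a, b)`: the alternating product `sₐ s_b sₐ ⋯` with `M a b` factors, the longest element
of the subgroup generated by `sₐ` and `s_b` when `M a b` is finite (i.e. nonzero). -/
def w0 (cs : CoxeterSystem M W) (a b : B) : W :=
  cs.wordProd (altWord a b (M a b))

/-- An element is bigrassmannian if it has exactly one left descent and exactly one
right descent. -/
def Bigrassmannian (cs : CoxeterSystem M W) (w : W) : Prop :=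
  (∃! i, cs.IsLeftDescent w i) ∧ (∃! j, cs.IsRightDescent w j)

/-- The support of `w`: the set of indices appearing in some reduced word for `w`. -/
def Supp (cs : CoxeterSystem M W) (w : W) : Set B :=
  {i | ∃ l : List B, cs.IsReduced l ∧ cs.wordProd l = w ∧ i ∈ l}

/-- The relation `(w, i, j) →_{(k,L)} (u, i', j')`. -/
def RedkL (cs : CoxeterSystem M W) (k : B) (x y : W × B × B) : Prop :=
  cs.length y.1 < cs.length x.1 ∧ RedR cs (x.1 * cs.simple k, x.2.1, x.2.2) x ∧
    RedL cs (x.1 * cs.simple k, x.2.1, x.2.2) y ∧ WeakLeftLE cs y.1 x.1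

/-- The relation `(w, i, j) →_{(k,R)} (u, i', j')`. -/
def RedkR (cs : CoxeterSystem M W) (k : B) (x y : W × B × B) : Prop :=
  cs.length y.1 < cs.length x.1 ∧ RedL cs (cs.simple k * x.1, x.2.1, x.2.2) x ∧
    RedR cs (cs.simple k * x.1, x.2.1, x.2.2) y ∧ WeakRightLE cs y.1 x.1

/-- The orthogonality condition for a bigrassmannian element `w` with `D_L(w) = {i}` and
`D_R(w) = {j}`. -/
def OrthCond (cs : CoxeterSystem M W) (w : W) (i j : B) : Prop :=
  (∀ a b : B, M a j = 2 → MapsSimple cs w a b → M b i = 2) ∧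
  (∀ a b : B, M a i = 2 → MapsSimple cs w⁻¹ a b → M b j = 2)

section AlternatingProducts

variable {G : Type*} [Group G]

/-- The alternating product `⋯ b a b a` with `n` factors, ending in `a`. -/
def altProd (a b : G) : ℕ → G
  | 0 => 1
  | n + 1 => altProd b a n * a

theorem altProd_mem_closure (n : ℕ) (a b : G) : altProd a b n ∈ Subgroup.closure {a, b} := by
  induction n generalizing a b with
  | zero => exact one_mem _
  | succ n ih =>
    refine mul_mem ?_ (Subgroup.subset_closure (by simp))
    rw [Set.pair_comm]
    exact ih b a

theorem altProd_succ_left (n : ℕ) (a b : G) :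
    (altProd a b (n + 1) = a * altProd a b n ∧ altProd b a (n + 1) = b * altProd b a n) ∨
      (altProd a b (n + 1) = b * altProd a b n ∧ altProd b a (n + 1) = a * altProd b a n) := by
  induction n with
  | zero => left; simp [altProd]
  | succ n ih =>
    rcases ih with ⟨h₁, h₂⟩ | ⟨h₁, h₂⟩
    · right
      constructor
      · rw [altProd, h₂, altProd, mul_assoc]
      · rw [altProd, h₁, altProd, mul_assoc]
    · left
      constructor
      · rw [altProd, h₂, altProd, mul_assoc]
      · rw [altProd, h₁, altProd, mul_assoc]

theorem altProd_mul_pow {a b : G} (ha : a * a = 1) (hb : b * b = 1) (n : ℕ) :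
    altProd b a n * (b * a) ^ n = altProd a b n := by
  induction n generalizing a b with
  | zero => simp [altProd]
  | succ n ih =>
    have hshift : a * (b * a) ^ n = (a * b) ^ n * a := by
      induction n with
      | zero => simp
      | succ n ih' =>
        exact (SemiconjBy.pow_right (show SemiconjBy a (b * a) (a * b) by
          simp [SemiconjBy, mul_assoc]) (n + 1)).eq
    calc altProd b a (n + 1) * (b * a) ^ (n + 1)
        = altProd a b n * ((b * b) * (a * (b * a) ^ n)) := by
          rw [altProd, pow_succ']; simp only [mul_assoc]
      _ = altProd a b n * (a * b) ^ n * a := by rw [hb, one_mul, hshift, mul_assoc]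
      _ = altProd a b (n + 1) := by rw [ih hb ha, altProd]

theorem orderOf_mul_swap (a b : G) : orderOf (a * b) = orderOf (b * a) := by
  have h : a * b = a * (b * a) * a⁻¹ := by group
  rw [h]
  exact (SemiconjBy.orderOf_eq a (SemiconjBy.conj_mk a (b * a))).symm

theorem altProd_orderOf {a b : G} (ha : a * a = 1) (hb : b * b = 1) :
    altProd b a (orderOf (a * b)) = altProd a b (orderOf (a * b)) := by
  have h := altProd_mul_pow ha hb (orderOf (a * b))
  rwa [orderOf_mul_swap a b, pow_orderOf_eq_one, mul_one, ← orderOf_mul_swap a b] at h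

theorem altProd_mul_self {a b : G} (ha : a * a = 1) (n : ℕ) :
    altProd a b (n + 1) * a = altProd b a n := by
  rw [altProd, mul_assoc, ha, mul_one]

theorem exists_altProd_mul {a b d : G} (ha : a * a = 1) (hb : b * b = 1)
    (hd : ∃ n, (orderOf (a * b) = 0 ∨ n ≤ orderOf (a * b)) ∧
      (d = altProd a b n ∨ d = altProd b a n)) :
    ∃ n, (orderOf (a * b) = 0 ∨ n ≤ orderOf (a * b)) ∧
      (d * a = altProd a b n ∨ d * a = altProd b a n) := by
  obtain ⟨n, hn, rfl | rfl⟩ := hd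
  · cases n with
    | zero =>
      refine ⟨1, by lia, .inl ?_⟩
      simp [altProd]
    | succ n => exact ⟨n, by lia, .inr (altProd_mul_self ha n)⟩
  · by_cases h : orderOf (a * b) = 0 ∨ n + 1 ≤ orderOf (a * b)
    · exact ⟨n + 1, h, .inl rfl⟩
    · obtain ⟨l, hl⟩ : ∃ l, orderOf (a * b) = l + 1 := ⟨orderOf (a * b) - 1, by lia⟩
      have hnl : n = orderOf (a * b) := by lia
      refine ⟨l, by lia, .inr ?_⟩
      rw [hnl, altProd_orderOf ha hb, hl, altProd_mul_self ha]

/-- Every element of a group generated by two involutions is an alternating product with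
at most as many factors as the order of their product. -/
theorem exists_eq_altProd {a b d : G} (ha : a * a = 1) (hb : b * b = 1)
    (hd : d ∈ Subgroup.closure {a, b}) :
    ∃ n, (orderOf (a * b) = 0 ∨ n ≤ orderOf (a * b)) ∧
      (d = altProd a b n ∨ d = altProd b a n) := by
  have step : ∀ x y : G, y ∈ ({a, b} : Set G) →
      (∃ n, (orderOf (a * b) = 0 ∨ n ≤ orderOf (a * b)) ∧
        (x = altProd a b n ∨ x = altProd b a n)) →
      ∃ n, (orderOf (a * b) = 0 ∨ n ≤ orderOf (a * b)) ∧
        (x * y = altProd a b n ∨ x * y = altProd b a n) := by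
    rintro x y (rfl | rfl) hx
    · exact exists_altProd_mul ha hb hx
    · obtain ⟨n, hn, hx⟩ := hx
      rw [orderOf_mul_swap] at hn ⊢
      obtain ⟨l, hl, hxl⟩ := exists_altProd_mul hb ha ⟨n, hn, hx.symm⟩
      exact ⟨l, hl, hxl.symm⟩
  induction hd using Subgroup.closure_induction_right with
  | one => exact ⟨0, by lia, .inl rfl⟩
  | mul_right x _ y hy ih => exact step x y hy ih
  | mul_inv_cancel x _ y hy ih =>
    have hyy : y⁻¹ = y := by
      rcases hy with rfl | rfl <;> exact inv_eq_of_mul_eq_one_left ‹_›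
    rw [hyy]
    exact step x y hy ih

end AlternatingProducts

section InversionParity

theorem pow_conj_eq_iff {G : Type*} [Group G] {a b : G} (ha : a * a = 1) (hb : b * b = 1)
    (n : ℕ) (t c : G) :
    (a * b) ^ n * t * ((a * b) ^ n)⁻¹ = c * b ↔ t = (b * a) ^ n * c * (b * a) ^ n * b := by
  have hinv : ((a * b) ^ n)⁻¹ = (b * a) ^ n := by
    rw [← inv_pow, mul_inv_rev, inv_eq_of_mul_eq_one_left ha, inv_eq_of_mul_eq_one_left hb]
  have hshift : b * (a * b) ^ n = (b * a) ^ n * b :=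
    (SemiconjBy.pow_right (show SemiconjBy b (a * b) (b * a) by
      simp [SemiconjBy, mul_assoc]) n).eq
  rw [mul_inv_eq_iff_eq_mul, ← eq_inv_mul_iff_mul_eq, hinv, mul_assoc c b, hshift]
  simp only [mul_assoc]

open Classical in
/-- The action of the simple reflection `sᵢ` on signed group elements: conjugation by `sᵢ`,
flipping the sign of `sᵢ` itself. -/
noncomputable def signedConj (cs : CoxeterSystem M W) (i : B) (x : W × ZMod 2) : W × ZMod 2 :=
  (cs.simple i * x.1 * cs.simple i, x.2 + if x.1 = cs.simple i then 1 else 0)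

open Classical in
theorem signedConj_mul_iterate (cs : CoxeterSystem M W) (i j : B) (n : ℕ) (x : W × ZMod 2) :
    ((signedConj cs i ∘ signedConj cs j)^[n]) x =
      ((cs.simple i * cs.simple j) ^ n * x.1 * ((cs.simple i * cs.simple j) ^ n)⁻¹,
        x.2 + ∑ k ∈ Finset.range (2 * n),
          if x.1 = (cs.simple j * cs.simple i) ^ k * cs.simple j then 1 else 0) := by
  induction n with
  | zero => simp
  | succ n ih =>
    rw [Function.iterate_succ_apply', ih]
    have hi := cs.simple_mul_simple_self i
    have hj := cs.simple_mul_simple_self j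
    set a := cs.simple i
    set b := cs.simple j
    have h₁ : (a * b) ^ n * x.1 * ((a * b) ^ n)⁻¹ = b ↔ x.1 = (b * a) ^ (2 * n) * b := by
      have := pow_conj_eq_iff hi hj n x.1 1
      rwa [one_mul, mul_one, ← pow_add, ← two_mul] at this
    have h₂ : b * ((a * b) ^ n * x.1 * ((a * b) ^ n)⁻¹) * b = a ↔
        x.1 = (b * a) ^ (2 * n + 1) * b := by
      have := pow_conj_eq_iff hi hj n x.1 (b * a)
      rw [← pow_succ, ← pow_add, show n + 1 + n = 2 * n + 1 by lia] at this
      rw [← this, ← eq_mul_inv_iff_mul_eq, ← eq_inv_mul_iff_mul_eq,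
        inv_eq_of_mul_eq_one_left hj, mul_assoc b a b]
    ext
    · simp only [Function.comp_apply, signedConj]
      rw [pow_succ', mul_inv_rev (a * b), mul_inv_rev a b, inv_eq_of_mul_eq_one_left hi,
        inv_eq_of_mul_eq_one_left hj]
      simp only [a, b, mul_assoc]
    · simp only [Function.comp_apply, signedConj]
      rw [show 2 * (n + 1) = 2 * n + 1 + 1 by lia, Finset.sum_range_succ, Finset.sum_range_succ]
      simp only [a, b] at h₁ h₂ ⊢
      simp only [h₁, h₂, add_assoc]

theorem signedConj_isLiftable (cs : CoxeterSystem M W) :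
    M.IsLiftable (G := Function.End (W × ZMod 2)) (signedConj cs) := by
  classical
  intro i j
  have hpow : ∀ n : ℕ, ∀ f : Function.End (W × ZMod 2), ∀ x, (f ^ n) x = f^[n] x := by
    intro n f
    induction n with
    | zero => intro x; rfl
    | succ n ih =>
      intro x
      exact (congrFun (pow_succ f n) x).trans (ih (f x))
  funext x
  rw [hpow]
  refine (signedConj_mul_iterate cs i j (M i j) x).trans ?_
  have hji : (cs.simple j * cs.simple i) ^ M i j = 1 := by
    rw [M.symmetric]; exact cs.simple_mul_simple_pow j i
  rw [cs.simple_mul_simple_pow, two_mul, Finset.sum_range_add]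
  simp only [pow_add, hji, one_mul, inv_one, mul_one, CharTwo.add_self_eq_zero, add_zero]
  rfl

/-- The action of a Coxeter group on signed group elements extending `signedConj`. -/
noncomputable def signedConjHom (cs : CoxeterSystem M W) : W →* Function.End (W × ZMod 2) :=
  cs.lift (G := Function.End (W × ZMod 2)) ⟨signedConj cs, signedConj_isLiftable cs⟩

theorem signedConjHom_simple (cs : CoxeterSystem M W) (i : B) (x : W × ZMod 2) :
    signedConjHom cs (cs.simple i) x = signedConj cs i x :=
  congrFun (cs.lift_apply_simple (G := Function.End (W × ZMod 2)) (signedConj_isLiftable cs) i) x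

theorem signedConjHom_mul (cs : CoxeterSystem M W) (u v : W) (x : W × ZMod 2) :
    signedConjHom cs (u * v) x = signedConjHom cs u (signedConjHom cs v x) :=
  congrFun (map_mul (signedConjHom cs) u v) x

theorem signedConjHom_one (cs : CoxeterSystem M W) (x : W × ZMod 2) :
    signedConjHom cs 1 x = x :=
  congrFun (map_one (signedConjHom cs)) x

/-- The parity of the number of occurrences of `t` in the right inversion sequence of any word
for `w`. -/
noncomputable def inversionParity (cs : CoxeterSystem M W) (w t : W) : ZMod 2 :=
  (signedConjHom cs w (t, 0)).2

theorem signedConjHom_apply (cs : CoxeterSystem M W) (w t : W) (e : ZMod 2) :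
    signedConjHom cs w (t, e) = (w * t * w⁻¹, e + inversionParity cs w t) := by
  induction w using cs.simple_induction_left generalizing t e with
  | one => simp [inversionParity, signedConjHom_one]
  | mul_simple_left w i ih =>
    rw [inversionParity, signedConjHom_mul, signedConjHom_mul, ih, ih, signedConjHom_simple,
      signedConjHom_simple]
    simp [signedConj, mul_assoc, add_assoc]

theorem inversionParity_mul (cs : CoxeterSystem M W) (u v t : W) :
    inversionParity cs (u * v) t =
      inversionParity cs v t + inversionParity cs u (v * t * v⁻¹) := by
  rw [inversionParity, signedConjHom_mul, signedConjHom_apply, signedConjHom_apply, zero_add]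

theorem inversionParity_one (cs : CoxeterSystem M W) (t : W) : inversionParity cs 1 t = 0 := by
  rw [inversionParity, signedConjHom_one]

open Classical in
theorem inversionParity_simple (cs : CoxeterSystem M W) (i : B) (t : W) :
    inversionParity cs (cs.simple i) t = if t = cs.simple i then 1 else 0 := by
  rw [inversionParity, signedConjHom_simple]
  simp [signedConj]

theorem length_mul_lt_of_inversionParity_ne_zero (cs : CoxeterSystem M W) {w t : W}
    (h : inversionParity cs w t ≠ 0) : cs.length (w * t) < cs.length w := by
  classical
  have key : ∀ ω : List B, inversionParity cs (cs.wordProd ω) t ≠ 0 → t ∈ cs.rightInvSeq ω := by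
    intro ω
    induction ω with
    | nil => simp [inversionParity_one]
    | cons i ω ih =>
      intro h
      rw [cs.wordProd_cons, inversionParity_mul, inversionParity_simple] at h
      rw [CoxeterSystem.rightInvSeq, List.mem_cons]
      by_cases ht : cs.wordProd ω * t * (cs.wordProd ω)⁻¹ = cs.simple i
      · left
        rw [← ht]
        group
      · right
        rw [if_neg ht, add_zero] at h
        exact ih h
  obtain ⟨ω, hω, rfl⟩ := cs.exists_isReduced w
  exact (cs.isRightInversion_of_mem_rightInvSeq hω (key ω h)).2

theorem inversionParity_simple_ne_zero (cs : CoxeterSystem M W) {w : W} {i : B}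
    (h : cs.IsRightDescent w i) : inversionParity cs w (cs.simple i) ≠ 0 := by
  intro h0
  have h1 : inversionParity cs (w * cs.simple i) (cs.simple i) ≠ 0 := by
    rw [inversionParity_mul, inversionParity_simple]
    simp [h0]
  have h2 := length_mul_lt_of_inversionParity_ne_zero cs h1
  rw [cs.simple_mul_simple_cancel_right] at h2
  exact lt_asymm h h2

end InversionParity

section DihedralCosets

theorem eq_of_inversionParity_altProd_ne_zero (cs : CoxeterSystem M W) (n : ℕ) {p q : B} {t : W}
    (h : inversionParity cs (altProd (cs.simple p) (cs.simple q) n) t ≠ 0) :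
    ∃ k < n, t = (cs.simple p * cs.simple q) ^ k * cs.simple p := by
  classical
  induction n generalizing p q t with
  | zero => simp [altProd, inversionParity_one] at h
  | succ n ih =>
    rw [altProd, inversionParity_mul, inversionParity_simple] at h
    by_cases ht : t = cs.simple p
    · exact ⟨0, by lia, by simpa using ht⟩
    · rw [if_neg ht, zero_add] at h
      obtain ⟨k, hk, hkt⟩ := ih h
      refine ⟨k + 1, by lia, ?_⟩
      rw [mul_inv_eq_iff_eq_mul, ← eq_inv_mul_iff_mul_eq, cs.inv_simple] at hkt
      have hshift : cs.simple p * (cs.simple q * cs.simple p) ^ k =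
          (cs.simple p * cs.simple q) ^ k * cs.simple p :=
        (SemiconjBy.pow_right (show SemiconjBy (cs.simple p) (cs.simple q * cs.simple p)
          (cs.simple p * cs.simple q) by simp [SemiconjBy, mul_assoc]) k).eq
      rw [hkt, ← mul_assoc, ← mul_assoc, hshift, pow_succ]
      simp only [mul_assoc]

theorem orderOf_le_of_inversionParity_altProd_ne_zero (cs : CoxeterSystem M W) {n : ℕ} {p q : B}
    (h : inversionParity cs (altProd (cs.simple p) (cs.simple q) n) (cs.simple q) ≠ 0) :
    0 < orderOf (cs.simple p * cs.simple q) ∧ orderOf (cs.simple p * cs.simple q) ≤ n := by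
  obtain ⟨k, hk, hkt⟩ := eq_of_inversionParity_altProd_ne_zero cs n h
  have hpow : (cs.simple p * cs.simple q) ^ (k + 1) = 1 := by
    rw [pow_succ, ← mul_assoc, ← hkt, cs.simple_mul_simple_self]
  have hle := orderOf_le_of_pow_eq_one (by lia) hpow
  exact ⟨orderOf_pos_iff.mpr (isOfFinOrder_iff_pow_eq_one.mpr ⟨k + 1, by lia, hpow⟩), by lia⟩

variable {cs : CoxeterSystem M W} {p q : B} {y : W}

theorem inversionParity_eq_zero_of_minimal
    (hy : ∀ d ∈ Subgroup.closure {cs.simple p, cs.simple q}, cs.length y ≤ cs.length (y * d))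
    {t : W} (ht : t ∈ Subgroup.closure {cs.simple p, cs.simple q}) :
    inversionParity cs y t = 0 := by
  by_contra h
  exact absurd (length_mul_lt_of_inversionParity_ne_zero cs h) (not_lt.mpr (hy t ht))

theorem inversionParity_mul_of_minimal
    (hy : ∀ d ∈ Subgroup.closure {cs.simple p, cs.simple q}, cs.length y ≤ cs.length (y * d))
    {d t : W} (hd : d ∈ Subgroup.closure {cs.simple p, cs.simple q})
    (ht : t ∈ Subgroup.closure {cs.simple p, cs.simple q}) :
    inversionParity cs (y * d) t = inversionParity cs d t := by
  rw [inversionParity_mul, inversionParity_eq_zero_of_minimal hy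
    (mul_mem (mul_mem hd ht) (inv_mem hd)), add_zero]

theorem length_mul_altProd
    (hy : ∀ d ∈ Subgroup.closure {cs.simple p, cs.simple q}, cs.length y ≤ cs.length (y * d))
    {n : ℕ} (hn : n ≤ orderOf (cs.simple p * cs.simple q)) :
    cs.length (y * altProd (cs.simple p) (cs.simple q) n) = cs.length y + n := by
  induction n generalizing p q with
  | zero => simp [altProd]
  | succ n ih =>
    rw [Set.pair_comm] at hy
    rw [orderOf_mul_swap] at hn
    have ih' := ih hy (by lia)
    rw [altProd, ← mul_assoc]
    have hnot : ¬ cs.IsRightDescent (y * altProd (cs.simple q) (cs.simple p) n) p := by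
      intro hdesc
      have h := inversionParity_simple_ne_zero cs hdesc
      rw [inversionParity_mul_of_minimal hy (altProd_mem_closure n _ _)
        (Subgroup.subset_closure (by simp))] at h
      have := (orderOf_le_of_inversionParity_altProd_ne_zero cs h).2
      lia
    rw [cs.not_isRightDescent_iff.mp hnot, ih']
    lia

theorem length_altProd (cs : CoxeterSystem M W) {p q : B}
    {n : ℕ} (hn : n ≤ orderOf (cs.simple p * cs.simple q)) :
    cs.length (altProd (cs.simple p) (cs.simple q) n) = n := by
  have h := length_mul_altProd (cs := cs) (p := p) (q := q) (y := 1) (by simp) hn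
  simpa using h

/-- An element with right descents `p` and `q` factors through the longest element of the
dihedral subgroup generated by `sₚ` and `s_q`. -/
theorem exists_eq_minimal_mul_altProd {x : W} (hp : cs.IsRightDescent x p)
    (hq : cs.IsRightDescent x q) :
    ∃ y, (∀ d ∈ Subgroup.closure {cs.simple p, cs.simple q},
        cs.length y ≤ cs.length (y * d)) ∧
      0 < orderOf (cs.simple p * cs.simple q) ∧
      x = y * altProd (cs.simple p) (cs.simple q) (orderOf (cs.simple p * cs.simple q)) := by
  obtain ⟨e, he⟩ := exists_minimalFor_of_wellFoundedLT
    (fun d => d ∈ Subgroup.closure {cs.simple p, cs.simple q})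
    (fun d => cs.length (x * d)) ⟨1, one_mem _⟩
  have hy : ∀ d ∈ Subgroup.closure {cs.simple p, cs.simple q},
      cs.length (x * e) ≤ cs.length (x * e * d) := by
    intro d hd
    rw [mul_assoc]
    exact (le_total _ _).elim id (he.2 (mul_mem he.1 hd))
  have hx : x = x * e * e⁻¹ := by group
  have hparity : ∀ t ∈ ({cs.simple p, cs.simple q} : Set W),
      inversionParity cs x t = inversionParity cs e⁻¹ t := by
    intro t ht
    conv_lhs => rw [hx]
    exact inversionParity_mul_of_minimal hy (inv_mem he.1) (Subgroup.subset_closure ht)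
  have hp' := inversionParity_simple_ne_zero cs hp
  have hq' := inversionParity_simple_ne_zero cs hq
  rw [hparity _ (by simp)] at hp' hq'
  refine ⟨x * e, hy, ?_⟩
  have hpp := cs.simple_mul_simple_self p
  have hqq := cs.simple_mul_simple_self q
  obtain ⟨n, hn, hd | hd⟩ := exists_eq_altProd hpp hqq (inv_mem he.1)
  · rw [hd] at hq'
    have hle := orderOf_le_of_inversionParity_altProd_ne_zero cs hq'
    refine ⟨hle.1, ?_⟩
    rw [show orderOf (cs.simple p * cs.simple q) = n by lia, ← hd]
    exact hx
  · rw [hd] at hp'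
    have hle := orderOf_le_of_inversionParity_altProd_ne_zero cs hp'
    rw [orderOf_mul_swap] at hle
    refine ⟨hle.1, ?_⟩
    rw [← altProd_orderOf hpp hqq, show orderOf (cs.simple p * cs.simple q) = n by lia, ← hd]
    exact hx

/-- If left multiplication by `sᵢ` shortens `y d` but lengthens the minimal coset representative
`y`, then it acts on `y` as right multiplication by one of the two generators. -/
theorem simple_mul_eq_of_minimal {i : B} {d : W}
    (hy : ∀ d ∈ Subgroup.closure {cs.simple p, cs.simple q}, cs.length y ≤ cs.length (y * d))
    (hpos : 0 < orderOf (cs.simple p * cs.simple q))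
    (hd : d ∈ Subgroup.closure {cs.simple p, cs.simple q})
    (hi : cs.IsLeftDescent (y * d) i) (hiy : ¬ cs.IsLeftDescent y i) :
    cs.simple i * y = y * cs.simple p ∨ cs.simple i * y = y * cs.simple q := by
  have hpp := cs.simple_mul_simple_self p
  have hqq := cs.simple_mul_simple_self q
  have h := inversionParity_simple_ne_zero cs (cs.isRightDescent_inv_iff.mpr hi)
  have hy0 : inversionParity cs y⁻¹ (cs.simple i) = 0 := by
    by_contra h0
    exact hiy (cs.isRightDescent_inv_iff.mp (length_mul_lt_of_inversionParity_ne_zero cs h0))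
  rw [mul_inv_rev, inversionParity_mul, hy0, zero_add, inv_inv] at h
  set t := y⁻¹ * cs.simple i * y with ht
  have hyt : cs.simple i * y = y * t := by rw [ht]; group
  have htmem : t ∈ Subgroup.closure {cs.simple p, cs.simple q} := by
    have hpm : cs.simple p ∈ Subgroup.closure {cs.simple p, cs.simple q} :=
      Subgroup.subset_closure (by simp)
    have hqm : cs.simple q ∈ Subgroup.closure {cs.simple p, cs.simple q} :=
      Subgroup.subset_closure (by simp)
    obtain ⟨n, -, hn | hn⟩ := exists_eq_altProd hpp hqq (inv_mem hd)
    · rw [hn] at h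
      obtain ⟨k, -, hk⟩ := eq_of_inversionParity_altProd_ne_zero cs n h
      rw [hk]
      exact mul_mem (pow_mem (mul_mem hpm hqm) k) hpm
    · rw [hn] at h
      obtain ⟨k, -, hk⟩ := eq_of_inversionParity_altProd_ne_zero cs n h
      rw [hk]
      exact mul_mem (pow_mem (mul_mem hqm hpm) k) hqm
  have hlen : cs.length (y * t) = cs.length y + 1 := by
    rw [← hyt]; exact cs.not_isLeftDescent_iff.mp hiy
  obtain ⟨n, hn, hn' | hn'⟩ := exists_eq_altProd hpp hqq htmem
  · have hl := length_mul_altProd hy (n := n) (by lia)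
    rw [← hn', hlen] at hl
    obtain rfl : n = 1 := by lia
    left
    rw [hyt, hn']
    simp [altProd]
  · rw [Set.pair_comm] at hy
    have hl := length_mul_altProd hy (n := n) (by rw [orderOf_mul_swap]; lia)
    rw [← hn', hlen] at hl
    obtain rfl : n = 1 := by lia
    right
    rw [hyt, hn']
    simp [altProd]

end DihedralCosets

section Inverses

variable {cs : CoxeterSystem M W}

theorem InGamma.inv {w : W} {i j : B} (h : InGamma cs (w, i, j)) : InGamma cs (w⁻¹, j, i) := by
  simp only [InGamma] at h ⊢
  rw [cs.length_inv, ← h, ← cs.length_inv (cs.simple i * w * cs.simple j)]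
  simp [mul_assoc]

theorem Bigrassmannian.inv {w : W} (h : Bigrassmannian cs w) : Bigrassmannian cs w⁻¹ := by
  simpa [Bigrassmannian, cs.isLeftDescent_inv_iff, cs.isRightDescent_inv_iff] using h.symm

theorem MapsSimple.inv {v : W} {a b : B} (h : MapsSimple cs v a b) : MapsSimple cs v⁻¹ b a := by
  obtain ⟨h₁, h₂⟩ := h
  refine ⟨by rw [← h₁]; group, ?_⟩
  rw [cs.length_inv, ← h₂, ← cs.length_inv, mul_inv_rev, inv_inv, cs.inv_simple, ← h₁]
  simp

theorem WeakRightLE.inv {u w : W} (h : WeakRightLE cs u w) : WeakLeftLE cs u⁻¹ w⁻¹ := by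
  simp only [WeakRightLE, WeakLeftLE] at h ⊢
  rw [cs.length_inv, cs.length_inv, ← h, ← cs.length_inv (u⁻¹ * w)]
  simp

theorem WeakLeftLE.inv {u w : W} (h : WeakLeftLE cs u w) : WeakRightLE cs u⁻¹ w⁻¹ := by
  simp only [WeakRightLE, WeakLeftLE] at h ⊢
  rw [cs.length_inv, cs.length_inv, ← h, ← cs.length_inv (w * u⁻¹)]
  simp

theorem RedL.inv {w u : W} {i j i' j' : B} (h : RedL cs (w, i, j) (u, i', j')) :
    RedR cs (w⁻¹, j, i) (u⁻¹, j', i') := by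
  obtain ⟨h₁, h₂, h₃, h₄, h₅⟩ := h
  exact ⟨h₁.inv, h₂.inv, h₃.inv, h₄, by simpa using h₅.inv⟩

theorem RedR.inv {w u : W} {i j i' j' : B} (h : RedR cs (w, i, j) (u, i', j')) :
    RedL cs (w⁻¹, j, i) (u⁻¹, j', i') := by
  obtain ⟨h₁, h₂, h₃, h₄, h₅⟩ := h
  exact ⟨h₁.inv, h₂.inv, h₃.inv, h₄, by simpa using h₅.inv⟩

theorem RedkR.inv {k : B} {w u : W} {i j i' j' : B} (h : RedkR cs k (w, i, j) (u, i', j')) :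
    RedkL cs k (w⁻¹, j, i) (u⁻¹, j', i') := by
  obtain ⟨h₁, h₂, h₃, h₄⟩ := h
  refine ⟨by simpa using h₁, ?_, ?_, h₄.inv⟩
  · simpa using h₂.inv
  · simpa using h₃.inv

end Inverses

theorem exists_redkR {cs : CoxeterSystem M W} {w : W} {i j k p : B}
    (hbg : Bigrassmannian cs w) (h : InGamma cs (w, i, j)) (hki : k ≠ i)
    (hcomm : cs.simple k * cs.simple i = cs.simple i * cs.simple k)
    (hkw : cs.simple k * w = w * cs.simple p)
    (hjp : cs.simple j * cs.simple p ≠ cs.simple p * cs.simple j) :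
    ∃ (v : W) (j' : B), RedkR cs k (w, i, j) (v, i, j') := by
  have hpp := cs.simple_mul_simple_self p
  have hjj := cs.simple_mul_simple_self j
  simp only [InGamma] at h
  have hwi : cs.length (cs.simple i * w) + 1 = cs.length w := by
    have := cs.length_mul_simple (cs.simple i * w) j
    have := cs.length_simple_mul w i
    lia
  have hwj : cs.length (w * cs.simple j) + 1 = cs.length w := by
    have := cs.length_simple_mul (w * cs.simple j) i
    rw [← mul_assoc] at this
    have := cs.length_mul_simple w j
    lia
  have hwk : ¬ cs.IsLeftDescent w k := fun hk =>
    hki (hbg.1.unique hk (cs.isLeftDescent_iff.mpr hwi))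
  have hlx : cs.length (cs.simple k * w) = cs.length w + 1 := cs.not_isLeftDescent_iff.mp hwk
  have hne : cs.simple k ≠ cs.simple i := by
    intro hs
    rw [hs] at hlx
    lia
  have hik : cs.length (cs.simple k * cs.simple i) = 2 := by
    have h1 := cs.length_mul_simple (cs.simple k) i
    rw [cs.length_simple] at h1
    have h0 : cs.length (cs.simple k * cs.simple i) ≠ 0 := by
      rw [Ne, cs.length_eq_zero_iff, mul_eq_one_iff_eq_inv, cs.inv_simple]
      exact hne
    lia
  have hxij : cs.length (cs.simple i * (cs.simple k * w) * cs.simple j) + 2 =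
      cs.length (cs.simple k * w) := by
    have h1 := cs.length_simple_mul (cs.simple i * w * cs.simple j) k
    have h2 : cs.simple i * (cs.simple k * w) * cs.simple j =
        cs.simple k * (cs.simple i * w * cs.simple j) := by
      simp only [← mul_assoc, hcomm]
    have h3 := cs.length_simple_mul (cs.simple k * w * cs.simple j) i
    have h4 := cs.length_mul_simple (cs.simple k * w) j
    rw [← mul_assoc, ← mul_assoc, mul_assoc _ (cs.simple k) w] at h3
    rw [← h2] at h1
    lia
  have hredL : RedL cs (cs.simple k * w, i, j) (w, i, j) := by
    refine ⟨hxij, h, ?_, rfl, ?_, ?_⟩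
    · simp only [WeakLeftLE, mul_inv_cancel_right, cs.length_simple]
      exact hlx.symm
    · simp only [mul_inv_cancel_right, hcomm]
    · simp only [mul_inv_cancel_right, hik, cs.length_simple]
  have hdp : cs.IsRightDescent (cs.simple k * w) p := by
    rw [CoxeterSystem.IsRightDescent, hlx, hkw, cs.simple_mul_simple_cancel_right]
    lia
  have hdj : cs.IsRightDescent (cs.simple k * w) j := by
    have := cs.length_simple_mul (w * cs.simple j) k
    rw [← mul_assoc] at this
    rw [CoxeterSystem.IsRightDescent]
    lia
  obtain ⟨y, hy, hpos, hx⟩ := exists_eq_minimal_mul_altProd hdp hdj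
  have hm3 : 3 ≤ orderOf (cs.simple p * cs.simple j) := by
    by_contra hlt
    have hpow := pow_orderOf_eq_one (cs.simple p * cs.simple j)
    refine hjp ?_
    have hinv : cs.simple j * cs.simple p = (cs.simple p * cs.simple j)⁻¹ := by simp
    obtain h1 | h1 : orderOf (cs.simple p * cs.simple j) = 1 ∨
        orderOf (cs.simple p * cs.simple j) = 2 := by lia
    · rw [h1, pow_one] at hpow
      rw [hinv, hpow, inv_one]
    · rw [h1, pow_two] at hpow
      rw [hinv, inv_eq_of_mul_eq_one_left hpow]
  have hswap := altProd_orderOf hpp hjj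
  have hlen {n : ℕ} := length_mul_altProd hy (n := n)
  have hlen₁ {n : ℕ} := length_altProd cs (p := p) (q := j) (n := n)
  have hlen₂ {n : ℕ} := length_altProd cs (p := j) (q := p) (n := n)
  rw [orderOf_mul_swap (cs.simple j)] at hlen₂
  have hlx' := hlen le_rfl
  rw [← hx, hlx] at hlx'
  obtain ⟨n, hn⟩ : ∃ n, orderOf (cs.simple p * cs.simple j) = n + 2 :=
    ⟨orderOf (cs.simple p * cs.simple j) - 2, by lia⟩
  rw [hn] at hswap hx hlen₁ hlen₂ hlx' hm3
  have hxj : cs.simple k * w * cs.simple j =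
      y * altProd (cs.simple p) (cs.simple j) (n + 1) := by
    rw [hx, ← hswap, mul_assoc, altProd_mul_self hjj]
  have hxp : w = y * altProd (cs.simple j) (cs.simple p) (n + 1) := by
    rw [← altProd_mul_self hpp, ← mul_assoc, ← hx, hkw, cs.simple_mul_simple_cancel_right]
  obtain ⟨c, c', hc, hc', hcc⟩ : ∃ c c' : B,
      altProd (cs.simple p) (cs.simple j) (n + 2) =
        cs.simple c * altProd (cs.simple p) (cs.simple j) (n + 1) ∧
      altProd (cs.simple j) (cs.simple p) (n + 2) =
        cs.simple c' * altProd (cs.simple j) (cs.simple p) (n + 1) ∧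
      ((c = p ∧ c' = j) ∨ (c = j ∧ c' = p)) := by
    rcases altProd_succ_left (n + 1) (cs.simple p) (cs.simple j) with ⟨h₁, h₂⟩ | ⟨h₁, h₂⟩
    · exact ⟨p, j, h₁, h₂, .inl ⟨rfl, rfl⟩⟩
    · exact ⟨j, p, h₁, h₂, .inr ⟨rfl, rfl⟩⟩
  have hxi : cs.IsLeftDescent (cs.simple k * w) i := by
    have := cs.length_mul_simple (cs.simple i * (cs.simple k * w)) j
    rw [CoxeterSystem.IsLeftDescent]
    lia
  have hyi : cs.IsLeftDescent y i := by
    by_contra hiy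
    rw [hx] at hxi
    have hcases := simple_mul_eq_of_minimal hy hpos (altProd_mem_closure _ _ _) hxi hiy
    have hcases' : cs.simple i * y = y * cs.simple c ∨ cs.simple i * y = y * cs.simple c' := by
      rcases hcc with ⟨rfl, rfl⟩ | ⟨rfl, rfl⟩
      · exact hcases
      · exact hcases.symm
    rcases hcases' with heq | heq
    · have : cs.simple i * (cs.simple k * w) = cs.simple k * w * cs.simple j := by
        rw [hxj, hx, ← mul_assoc, heq, hc, mul_assoc, cs.simple_mul_simple_cancel_left]
      rw [this, cs.simple_mul_simple_cancel_right] at hxij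
      lia
    · have : cs.simple i * (cs.simple k * w) = w := by
        rw [hx, ← mul_assoc, heq, ← hswap, hc', mul_assoc, cs.simple_mul_simple_cancel_left,
          ← hxp]
      have h2 : cs.simple i * w = cs.simple k * w := by
        conv_lhs => rw [← this]
        exact cs.simple_mul_simple_cancel_left i
      rw [h2] at hwi
      lia
  have hmem : cs.simple c ∈ Subgroup.closure {cs.simple p, cs.simple j} := by
    apply Subgroup.subset_closure
    rcases hcc with ⟨rfl, -⟩ | ⟨rfl, -⟩ <;> simp
  have hv : cs.length (y * cs.simple c) = cs.length y + 1 := by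
    have := cs.length_mul_simple y c
    have := hy _ hmem
    lia
  have hvx : (y * cs.simple c)⁻¹ * (cs.simple k * w) =
      altProd (cs.simple p) (cs.simple j) (n + 1) := by
    rw [hx, hc]
    simp [mul_assoc]
  have hvw : (y * cs.simple c)⁻¹ * w = altProd (cs.simple j) (cs.simple p) n := by
    have : w = cs.simple k * w * cs.simple p := by
      rw [hkw, cs.simple_mul_simple_cancel_right]
    rw [this, ← mul_assoc, hvx, altProd_mul_self hpp]
  have hyi' := cs.isLeftDescent_iff.mp hyi
  refine ⟨y * cs.simple c, c, ?_, hredL, ⟨hxij, ?_, ?_, rfl, ?_, ?_⟩, ?_⟩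
  · simp only [hv]
    lia
  · simp only [InGamma]
    rw [mul_assoc, cs.simple_mul_simple_cancel_right, hv]
    lia
  · simp only [WeakRightLE]
    rw [hvx, hv, hlen₁ (by lia), hlx]
    lia
  · simp only [hvx]
    rw [mul_inv_eq_iff_eq_mul, ← hc, ← hswap]
    rfl
  · simp only [hvx]
    rw [hlen₁ (by lia)]
    exact hlen₂ le_rfl
  · simp only [WeakRightLE]
    rw [hvw, hv, hlen₂ (by lia)]
    lia

/-- Second-stage reductions for a bigrassmannian `w` with `(w, i, j) ∈ Γ(W)`. -/
theorem second_stage_reduction (cs : CoxeterSystem M W) (w : W) (i j : B)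
    (hbg : Bigrassmannian cs w) (h : InGamma cs (w, i, j)) :
    (∀ k : B, k ≠ i → cs.simple k * cs.simple i = cs.simple i * cs.simple k →
      (∃ p : B, cs.simple k * w = w * cs.simple p ∧
        cs.simple j * cs.simple p ≠ cs.simple p * cs.simple j) →
      ∃ (v : W) (j' : B), RedkR cs k (w, i, j) (v, i, j')) ∧
    (∀ k : B, k ≠ j → cs.simple k * cs.simple j = cs.simple j * cs.simple k →
      (∃ p : B, cs.simple p * w = w * cs.simple k ∧
        cs.simple i * cs.simple p ≠ cs.simple p * cs.simple i) →
      ∃ (v : W) (i' : B), RedkL cs k (w, i, j) (v, i', j)) := by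
  refine ⟨fun k hk hcomm ⟨p, hkw, hjp⟩ => exists_redkR hbg h hk hcomm hkw hjp,
    fun k hk hcomm ⟨p, hpw, hip⟩ => ?_⟩
  have hkw : cs.simple k * w⁻¹ = w⁻¹ * cs.simple p := by
    simpa using (congrArg (·⁻¹) hpw).symm
  obtain ⟨v, i', hv⟩ := exists_redkR hbg.inv h.inv hk hcomm hkw hip
  exact ⟨v⁻¹, i', by simpa using hv.inv⟩

end NilpotencyIndices
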